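/- For all positive integers p, q with 1 ≤ p < q and gcd(p,q) = 1, ψ((q−p)/q) = −γ − ln(2q) + (π/2)·cot(πp/q) + 2·Σ_{j=1}^{⌊q/2⌋} cos(2πpj/q)·ln(sin(πj/q)), where ψ is the digamma function and γ is the Euler–Mascheroni constant. -/

import Mathlib

noncomputable def digamma (x : ℝ) : ℝ := deriv Real.Gamma x / Real.Gamma x

open Filter Topology Finset

lemma hasDerivAt_log_Gamma {x : ℝ} (hx : 0 < x) :
    HasDerivAt (Real.log ∘ Real.Gamma) (digamma x) x :=
  (Real.differentiableAt_Gamma fun m => by linarith [(Nat.cast_nonneg m : (0 : ℝ) ≤ m)]).hasDerivAt.log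
    (Real.Gamma_pos_of_pos hx).ne'

lemma log_Gamma_add_one {x : ℝ} (hx : 0 < x) :
    Real.log (Real.Gamma (x + 1)) = Real.log (Real.Gamma x) + Real.log x := by
  rw [Real.Gamma_add_one hx.ne', Real.log_mul hx.ne' (Real.Gamma_pos_of_pos hx).ne', add_comm]

lemma digamma_add_one {x : ℝ} (hx : 0 < x) : digamma (x + 1) = digamma x + x⁻¹ := by
  have h₁ : HasDerivAt (fun y => Real.log (Real.Gamma (y + 1))) (digamma (x + 1)) x :=
    (hasDerivAt_log_Gamma (by linarith : 0 < x + 1)).comp_add_const x 1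
  have h₂ : HasDerivAt (fun y => Real.log (Real.Gamma y) + Real.log y) (digamma x + x⁻¹) x :=
    (hasDerivAt_log_Gamma hx).add (Real.hasDerivAt_log hx.ne')
  refine h₁.unique (h₂.congr_of_eventuallyEq ?_)
  filter_upwards [lt_mem_nhds hx] with y hy using log_Gamma_add_one hy

lemma digamma_add_natCast {x : ℝ} (hx : 0 < x) (n : ℕ) :
    digamma (x + n) = digamma x + ∑ k ∈ range n, (x + k)⁻¹ := by
  induction n with
  | zero => simp
  | succ n ih =>
    rw [Nat.cast_succ, ← add_assoc, digamma_add_one (by positivity), ih, sum_range_succ, add_assoc]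

lemma digamma_le_log {x : ℝ} (hx : 0 < x) : digamma x ≤ Real.log x := by
  have h := Real.convexOn_log_Gamma.le_slope_of_hasDerivAt (y := x + 1) hx
    (by simp only [Set.mem_Ioi]; linarith) (by linarith) (hasDerivAt_log_Gamma hx)
  simpa [slope_def_field, log_Gamma_add_one hx] using h

lemma log_le_digamma_add_one {x : ℝ} (hx : 0 < x) : Real.log x ≤ digamma (x + 1) := by
  have h := Real.convexOn_log_Gamma.slope_le_of_hasDerivAt (x := x) hx
    (by simp only [Set.mem_Ioi]; linarith) (by linarith)
    (hasDerivAt_log_Gamma (by linarith : 0 < x + 1))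
  simpa [slope_def_field, log_Gamma_add_one hx] using h

lemma tendsto_digamma_add_natCast_sub_log {x : ℝ} (hx : 0 < x) :
    Tendsto (fun n : ℕ => digamma (x + n) - Real.log n) atTop (𝓝 0) := by
  have h (c : ℝ) : Tendsto (fun n : ℕ => Real.log (n + c) - Real.log n) atTop (𝓝 0) :=
    (Real.tendsto_log_comp_add_sub_log c).comp tendsto_natCast_atTop_atTop
  refine tendsto_of_tendsto_of_tendsto_of_le_of_le' (h (x - 1)) (h x) ?_ ?_
  · filter_upwards [eventually_ge_atTop 1] with n hn
    have hn' : (1 : ℝ) ≤ n := by exact_mod_cast hn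
    have := log_le_digamma_add_one (by linarith : 0 < n + (x - 1))
    rw [show (n : ℝ) + (x - 1) + 1 = x + n by ring] at this
    linarith
  · filter_upwards with n
    have := digamma_le_log (by positivity : 0 < x + n)
    rw [add_comm (n : ℝ) x]
    linarith

/-- The series expansion of the digamma function, as a limit of partial sums. -/
lemma tendsto_sum_inv_sub_inv_digamma {x : ℝ} (hx : 0 < x) :
    Tendsto (fun n : ℕ => ∑ k ∈ range n, (((k : ℝ) + 1)⁻¹ - (x + k)⁻¹)) atTop
      (𝓝 (digamma x + Real.eulerMascheroniConstant)) := by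
  have h := (tendsto_digamma_add_natCast_sub_log hx).const_sub (digamma x)
  rw [sub_zero] at h
  refine (h.add Real.tendsto_harmonic_sub_log).congr fun n => ?_
  rw [digamma_add_natCast hx, sum_sub_distrib, harmonic]
  push_cast
  ring

lemma digamma_one_sub_sub_digamma {x : ℝ} (hx₀ : 0 < x) (hx₁ : x < 1) :
    digamma (1 - x) - digamma x = Real.pi * Real.cot (Real.pi * x) := by
  have hs : 0 < Real.sin (Real.pi * x) :=
    Real.sin_pos_of_pos_of_lt_pi (by positivity) (by nlinarith [Real.pi_pos])
  have h₁ : HasDerivAt (fun y => Real.log (Real.Gamma y) + Real.log (Real.Gamma (1 - y)))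
      (digamma x + -digamma (1 - x)) x :=
    (hasDerivAt_log_Gamma hx₀).add
      ((hasDerivAt_log_Gamma (by linarith : 0 < 1 - x)).comp_const_sub 1 x)
  have h₂ : HasDerivAt (fun y => Real.log Real.pi - Real.log (Real.sin (Real.pi * y)))
      (-(Real.cos (Real.pi * x) * (Real.pi * 1) / Real.sin (Real.pi * x))) x :=
    ((((hasDerivAt_id x).const_mul Real.pi).sin).log hs.ne').const_sub _
  have h := h₁.unique (h₂.congr_of_eventuallyEq ?_)
  · rw [Real.cot_eq_cos_div_sin]
    linear_combination -h
  · filter_upwards [Ioo_mem_nhds hx₀ hx₁] with y hy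
    have hsy : 0 < Real.sin (Real.pi * y) :=
      Real.sin_pos_of_pos_of_lt_pi (mul_pos Real.pi_pos hy.1) (by nlinarith [Real.pi_pos, hy.2])
    rw [← Real.log_mul (Real.Gamma_pos_of_pos hy.1).ne'
      (Real.Gamma_pos_of_pos (by linarith [hy.2])).ne', Real.Gamma_mul_Gamma_one_sub,
      Real.log_div Real.pi_ne_zero hsy.ne']

/-- The Taylor series of `-log (1 - z)` converges to it on the unit circle away from `1`. -/
lemma tendsto_sum_pow_div_neg_log {z : ℂ} (hz : ‖z‖ = 1) (hz₁ : z ≠ 1) :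
    Tendsto (fun n : ℕ => ∑ k ∈ range n, z ^ (k + 1) / (k + 1)) atTop
      (𝓝 (-Complex.log (1 - z))) := by
  have hb (n : ℕ) : ‖∑ k ∈ range n, z ^ (k + 1)‖ ≤ 2 / ‖z - 1‖ := by
    have : ∑ k ∈ range n, z ^ (k + 1) = z * ((z ^ n - 1) / (z - 1)) := by
      rw [← geom_sum_eq hz₁, mul_sum]
      exact sum_congr rfl fun _ _ => pow_succ' _ _
    rw [this, norm_mul, norm_div, hz, one_mul]
    gcongr
    calc ‖z ^ n - 1‖ ≤ ‖z ^ n‖ + ‖(1 : ℂ)‖ := norm_sub_le _ _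
      _ = 2 := by rw [norm_pow, hz]; norm_num
  have hanti : Antitone fun n : ℕ => 1 / ((n : ℝ) + 1) := fun a b hab => by
    simp only; gcongr
  obtain ⟨l, hl⟩ := cauchySeq_tendsto_of_complete
    (hanti.cauchySeq_series_mul_of_tendsto_zero_of_bounded
      tendsto_one_div_add_atTop_nhds_zero_nat hb)
  replace hl : Tendsto (fun n : ℕ => ∑ k ∈ range n, z ^ (k + 1) / (k + 1)) atTop (𝓝 l) := by
    refine hl.congr fun n => sum_congr rfl fun k _ => ?_
    rw [Complex.real_smul]
    push_cast
    ring
  have habel := tendsto_map'_iff.mp (Complex.tendsto_tsum_powerSeries_nhdsWithin_lt hl)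
  have hslit : 1 - z ∈ Complex.slitPlane := by
    by_contra h
    have h := Complex.mem_slitPlane_iff.not.mp h
    push Not at h
    simp only [Complex.sub_re, Complex.one_re, Complex.sub_im, Complex.one_im] at h
    have h1 := Complex.re_le_norm z
    exact hz₁ (Complex.ext (by simp; linarith) (by simp; linarith [h.2]))
  have hcont : Tendsto (fun t : ℝ => -Complex.log (1 - z * t)) (𝓝[<] 1)
      (𝓝 (-Complex.log (1 - z))) := by
    have h : ContinuousAt (fun t : ℝ => -Complex.log (1 - z * t)) 1 :=
      (ContinuousAt.clog (by fun_prop) (by simpa using hslit)).neg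
    simpa using h.tendsto.mono_left nhdsWithin_le_nhds
  have hid : Tendsto (fun t : ℝ => (t : ℂ)) (𝓝[<] 1) (𝓝 1) := by
    simpa using (Complex.continuous_ofReal.tendsto 1).mono_left nhdsWithin_le_nhds
  have hmul := hid.mul habel
  rw [one_mul] at hmul
  refine tendsto_nhds_unique (hcont.congr' ?_) hmul ▸ hl
  filter_upwards [Ioo_mem_nhdsLT (zero_lt_one' ℝ)] with t ht
  have hzt : ‖z * t‖ < 1 := by
    rw [norm_mul, hz, one_mul, Complex.norm_real, Real.norm_of_nonneg ht.1.le]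
    exact ht.2
  rw [← (Complex.hasSum_taylorSeries_neg_log' hzt).tsum_eq, Function.comp_apply, ← tsum_mul_left]
  exact tsum_congr fun n => by ring

lemma neg_log_one_sub_exp_re {θ : ℝ} (h₀ : 0 < θ) (h₁ : θ < 2 * Real.pi) :
    (-Complex.log (1 - Complex.exp (Complex.I * θ))).re = -Real.log (2 * Real.sin (θ / 2)) := by
  rw [Complex.neg_re, Complex.log_re, norm_sub_rev, Complex.norm_exp_I_mul_ofReal_sub_one,
    Real.norm_of_nonneg]
  have := Real.sin_pos_of_pos_of_lt_pi (x := θ / 2) (by linarith) (by linarith)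
  positivity

lemma tendsto_sum_cos_div {θ : ℝ} (h₀ : 0 < θ) (h₁ : θ < 2 * Real.pi) :
    Tendsto (fun n : ℕ => ∑ k ∈ range n, Real.cos ((k + 1) * θ) / (k + 1)) atTop
      (𝓝 (-Real.log (2 * Real.sin (θ / 2)))) := by
  have hne : Complex.exp (Complex.I * θ) ≠ 1 := by
    rw [← sub_ne_zero, ← norm_ne_zero_iff, Complex.norm_exp_I_mul_ofReal_sub_one]
    have := Real.sin_pos_of_pos_of_lt_pi (x := θ / 2) (by linarith) (by linarith)
    exact norm_ne_zero_iff.mpr (by positivity)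
  rw [← neg_log_one_sub_exp_re h₀ h₁]
  refine ((Complex.continuous_re.tendsto _).comp
    (tendsto_sum_pow_div_neg_log (by simp [Complex.norm_exp]) hne)).congr fun n => ?_
  simp only [Function.comp_apply, Complex.re_sum]
  refine sum_congr rfl fun k _ => ?_
  rw [← Complex.exp_nat_mul]
  have : ((k + 1 : ℕ) : ℂ) * (Complex.I * θ) = (((k + 1) * θ : ℝ) : ℂ) * Complex.I := by
    push_cast; ring
  rw [this, show ((k : ℂ) + 1) = ((k + 1 : ℝ) : ℂ) by push_cast; rfl, Complex.div_ofReal_re,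
    Complex.exp_ofReal_mul_I_re]

lemma sum_cos_two_pi_mul_div {q : ℕ} (hq : 0 < q) (m : ℤ) :
    ∑ j ∈ range q, Real.cos (2 * Real.pi * m * j / q) = if (q : ℤ) ∣ m then (q : ℝ) else 0 := by
  have hq' : (q : ℂ) ≠ 0 := by exact_mod_cast hq.ne'
  have hπ : (Real.pi : ℂ) ≠ 0 := by exact_mod_cast Real.pi_ne_zero
  set z : ℂ := Complex.exp (2 * Real.pi * Complex.I * (m / q)) with hz
  have hsum : ∑ j ∈ range q, Real.cos (2 * Real.pi * m * j / q) = (∑ j ∈ range q, z ^ j).re := by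
    rw [Complex.re_sum]
    refine sum_congr rfl fun j _ => ?_
    rw [hz, ← Complex.exp_nat_mul, ← Complex.exp_ofReal_mul_I_re]
    congr 2
    push_cast
    ring
  have hzq : z ^ q = 1 := by
    rw [hz, ← Complex.exp_nat_mul, Complex.exp_eq_one_iff]
    exact ⟨m, by field_simp⟩
  have hz₁ : z = 1 ↔ (q : ℤ) ∣ m := by
    rw [hz, Complex.exp_eq_one_iff]
    constructor
    · rintro ⟨n, hn⟩
      refine ⟨n, ?_⟩
      field_simp at hn
      have := Complex.I_ne_zero
      exact_mod_cast (by simpa using hn : (m : ℂ) = q * n)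
    · rintro ⟨n, rfl⟩
      exact ⟨n, by push_cast; field_simp⟩
  rw [hsum]
  split_ifs with h
  · simp [hz₁.mpr h]
  · rw [geom_sum_eq (mt hz₁.mp h), hzq]
    simp

lemma sum_log_two_mul_sin {q : ℕ} (hq : 0 < q) :
    ∑ j ∈ range (q - 1), Real.log (2 * Real.sin (Real.pi * (j + 1) / q)) = Real.log q := by
  obtain ⟨n, rfl⟩ : ∃ n, q = n + 1 := ⟨q - 1, by omega⟩
  have h := (Complex.isPrimitiveRoot_exp (n + 1) n.succ_ne_zero).prod_one_sub_pow_eq_order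
  have hpos : ∀ j ∈ range n, 0 < Real.sin (Real.pi * (j + 1) / (n + 1 : ℕ)) := fun j hj => by
    have : (j : ℝ) + 1 < n + 1 := by exact_mod_cast Nat.succ_lt_succ (mem_range.mp hj)
    refine Real.sin_pos_of_pos_of_lt_pi (by positivity) ?_
    push_cast
    rw [div_lt_iff₀ (by positivity)]
    exact mul_lt_mul_of_pos_left this Real.pi_pos
  rw [Nat.add_sub_cancel, ← Real.log_prod fun j hj => by have := hpos j hj; positivity]
  congr 1
  have h := congrArg norm h
  rw [norm_prod] at h
  have hn : ‖(n : ℂ) + 1‖ = (n + 1 : ℕ) := by exact_mod_cast Complex.norm_natCast (n + 1)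
  refine Eq.trans ?_ (h.trans hn)
  refine prod_congr rfl fun j hj => ?_
  have he : Complex.exp (2 * Real.pi * Complex.I / (n + 1 : ℕ)) ^ (j + 1) =
      Complex.exp (Complex.I * ((2 * (Real.pi * (j + 1) / (n + 1 : ℕ)) : ℝ) : ℂ)) := by
    rw [← Complex.exp_nat_mul]
    congr 1
    push_cast
    ring
  have := hpos j hj
  rw [he, norm_sub_rev, Complex.norm_exp_I_mul_ofReal_sub_one, mul_div_cancel_left₀ _ two_ne_zero,
    Real.norm_of_nonneg (by positivity)]

lemma sum_range_ite_dvd_div {q s : ℕ} (hs : 0 < s) (hsq : s ≤ q) (n : ℕ) :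
    ∑ i ∈ range q, (if (q : ℤ) ∣ ((n * q + i : ℕ) : ℤ) + 1 - s then (q : ℝ) else 0) /
      ((n * q + i : ℕ) + 1) = ((s : ℝ) / q + n)⁻¹ := by
  have hq : (0 : ℝ) < q := by exact_mod_cast hs.trans_le hsq
  rw [sum_eq_single (s - 1)]
  · have hcast : ((s - 1 : ℕ) : ℝ) = s - 1 := Nat.cast_pred hs
    have hcast' : ((s - 1 : ℕ) : ℤ) = s - 1 := Nat.cast_pred hs
    rw [if_pos ⟨n, by push_cast [hcast']; ring⟩]
    have : (0 : ℝ) < s := by exact_mod_cast hs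
    push_cast [hcast]
    rw [show (n : ℝ) * q + (s - 1) + 1 = n * q + s by ring]
    field_simp
    ring
  · intro i hi his
    rw [if_neg, zero_div]
    intro hdvd
    have h : (q : ℤ) ∣ (i : ℤ) + 1 - s := by
      rw [show (i : ℤ) + 1 - s = ((n * q + i : ℕ) : ℤ) + 1 - s - n * q by push_cast; ring]
      exact dvd_sub hdvd (Dvd.intro_left _ rfl)
    have hi := mem_range.mp hi
    have := Int.eq_zero_of_abs_lt_dvd h (by rw [abs_lt]; omega)
    omega
  · intro h
    exact absurd (mem_range.mpr (by omega)) h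

lemma sum_one_sub_cos_mul_cos {q r : ℕ} (hr : 0 < r) (hrq : r < q) (m : ℕ) :
    ∑ j ∈ range (q - 1), 2 * (1 - Real.cos (2 * Real.pi * r * (j + 1) / q)) *
        Real.cos ((m + 1) * (2 * Real.pi * (j + 1) / q)) =
      2 * (if (q : ℤ) ∣ (m : ℤ) + 1 - q then (q : ℝ) else 0)
        - (if (q : ℤ) ∣ (m : ℤ) + 1 - (q - r : ℕ) then (q : ℝ) else 0)
        - (if (q : ℤ) ∣ (m : ℤ) + 1 - r then (q : ℝ) else 0) := by
  have hq : 0 < q := hr.trans hrq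
  have h₁ : (q : ℤ) ∣ (m : ℤ) + 1 - q ↔ (q : ℤ) ∣ (m : ℤ) + 1 := by simp
  have h₂ : (q : ℤ) ∣ (m : ℤ) + 1 - (q - r : ℕ) ↔ (q : ℤ) ∣ (m : ℤ) + 1 + r := by
    rw [Nat.cast_sub hrq.le, show (m : ℤ) + 1 - (q - r) = m + 1 + r - q by ring, dvd_sub_self_right]
  simp only [h₁, h₂, ← sum_cos_two_pi_mul_div hq]
  rw [mul_sum, ← sum_sub_distrib, ← sum_sub_distrib]
  obtain ⟨n, rfl⟩ : ∃ n, q = n + 1 := ⟨q - 1, by omega⟩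
  rw [sum_range_succ', Nat.add_sub_cancel]
  simp only [Nat.cast_zero, mul_zero, zero_div, Real.cos_zero]
  rw [show (2 : ℝ) * 1 - 1 - 1 = 0 by norm_num, add_zero]
  refine sum_congr rfl fun j _ => ?_
  set θ : ℝ := 2 * Real.pi * (j + 1) / (n + 1 : ℕ) with hθ
  have e₁ : 2 * Real.pi * r * (j + 1) / (n + 1 : ℕ) = r * θ := by rw [hθ]; ring
  have e₂ : 2 * Real.pi * ((m + 1 : ℤ) : ℝ) * (j + 1 : ℕ) / (n + 1 : ℕ) = (m + 1) * θ := by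
    rw [hθ]; push_cast; ring
  have e₃ : 2 * Real.pi * ((m + 1 + r : ℤ) : ℝ) * (j + 1 : ℕ) / (n + 1 : ℕ) =
      (m + 1) * θ + r * θ := by
    rw [hθ]; push_cast; ring
  have e₄ : 2 * Real.pi * ((m + 1 - r : ℤ) : ℝ) * (j + 1 : ℕ) / (n + 1 : ℕ) =
      (m + 1) * θ - r * θ := by
    rw [hθ]; push_cast; ring
  rw [e₁, e₂, e₃, e₄, Real.cos_add, Real.cos_sub]
  ring

lemma sum_range_mul_one_sub_cos {q r : ℕ} (hr : 0 < r) (hrq : r < q) (n : ℕ) :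
    ∑ m ∈ range (n * q), (∑ j ∈ range (q - 1), 2 * (1 - Real.cos (2 * Real.pi * r * (j + 1) / q)) *
        Real.cos ((m + 1) * (2 * Real.pi * (j + 1) / q))) / (m + 1) =
      ∑ k ∈ range n, (((k : ℝ) + 1)⁻¹ - ((r : ℝ) / q + k)⁻¹) +
        ∑ k ∈ range n, (((k : ℝ) + 1)⁻¹ - (1 - (r : ℝ) / q + k)⁻¹) := by
  have hq : (0 : ℝ) < q := by exact_mod_cast hr.trans hrq
  simp only [sum_one_sub_cos_mul_cos hr hrq]
  induction n with
  | zero => simp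
  | succ n ih =>
    rw [Nat.succ_mul, sum_range_add, ih, sum_range_succ, sum_range_succ]
    simp only [sub_div, mul_div_assoc, sum_sub_distrib, ← mul_sum]
    rw [sum_range_ite_dvd_div (hr.trans hrq) le_rfl, sum_range_ite_dvd_div hr hrq.le,
      sum_range_ite_dvd_div (Nat.sub_pos_of_lt hrq) (Nat.sub_le _ _), Nat.cast_sub hrq.le, sub_div,
      div_self hq.ne']
    ring

lemma digamma_add_digamma_one_sub {q r : ℕ} (hr : 0 < r) (hrq : r < q) :
    digamma (r / q) + digamma (1 - r / q) + 2 * Real.eulerMascheroniConstant =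
      ∑ j ∈ range (q - 1), 2 * (1 - Real.cos (2 * Real.pi * r * (j + 1) / q)) *
        -Real.log (2 * Real.sin (Real.pi * (j + 1) / q)) := by
  have hq : (0 : ℝ) < q := by exact_mod_cast hr.trans hrq
  have hr' : (0 : ℝ) < r := by exact_mod_cast hr
  have hrq' : (r : ℝ) / q < 1 := (div_lt_one hq).mpr (by exact_mod_cast hrq)
  have hψ := (tendsto_sum_inv_sub_inv_digamma (x := r / q) (by positivity)).add
    (tendsto_sum_inv_sub_inv_digamma (x := 1 - r / q) (by linarith))
  simp only [← sum_range_mul_one_sub_cos hr hrq] at hψ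
  have hlog : Tendsto (fun n : ℕ => ∑ j ∈ range (q - 1),
      2 * (1 - Real.cos (2 * Real.pi * r * (j + 1) / q)) *
        ∑ m ∈ range (n * q), Real.cos ((m + 1) * (2 * Real.pi * (j + 1) / q)) / (m + 1)) atTop
      (𝓝 (∑ j ∈ range (q - 1), 2 * (1 - Real.cos (2 * Real.pi * r * (j + 1) / q)) *
        -Real.log (2 * Real.sin (Real.pi * (j + 1) / q)))) := by
    refine tendsto_finsetSum _ fun j hj => Tendsto.const_mul _ ?_
    have hj : (j : ℝ) + 1 < q := by
      have := mem_range.mp hj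
      exact_mod_cast (by omega : j + 1 < q)
    have h := tendsto_sum_cos_div (θ := 2 * Real.pi * (j + 1) / q) (by positivity) (by
      rw [div_lt_iff₀ hq]
      exact mul_lt_mul_of_pos_left hj Real.two_pi_pos)
    rw [show 2 * Real.pi * (j + 1) / q / 2 = Real.pi * (j + 1) / q by ring] at h
    exact h.comp (tendsto_id.atTop_mul_const' (hr.trans hrq))
  have h := tendsto_nhds_unique (hψ.congr fun n => ?_) hlog
  · linear_combination h
  · simp only [mul_sum, sum_div]
    rw [sum_comm]
    simp only [mul_div_assoc]

lemma sum_range_pred_of_symm {q : ℕ} (hq : 0 < q) (f : ℕ → ℝ)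
    (hf : ∀ j, 0 < j → j < q → f (q - j) = f j) (hmid : ∀ j, 2 * j = q → f j = 0) :
    ∑ j ∈ range (q - 1), f (j + 1) = 2 * ∑ j ∈ Icc 1 (q / 2), f j := by
  have h₁ : ∑ j ∈ range (q - 1), f (j + 1) = ∑ j ∈ Ico 1 q, f j := by
    rw [sum_Ico_eq_sum_range]
    simp only [add_comm]
  have h₂ : ∑ j ∈ Ico (q / 2 + 1) q, f j = ∑ j ∈ Ico 1 (q - q / 2), f j := by
    refine sum_nbij' (q - ·) (q - ·) ?_ ?_ ?_ ?_ ?_ <;> intro j hj <;> simp only [mem_Ico] at hj ⊢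
    · omega
    · omega
    · omega
    · omega
    · exact (hf j (by omega) (by omega)).symm
  have h₃ : ∑ j ∈ Ico 1 (q - q / 2), f j = ∑ j ∈ Ico 1 (q / 2 + 1), f j := by
    refine sum_subset (fun j hj => ?_) fun j hj hj' => hmid j ?_
    · simp only [mem_Ico] at hj ⊢; omega
    · simp only [mem_Ico] at hj hj'; omega
  rw [h₁, ← sum_Ico_consecutive f (show 1 ≤ q / 2 + 1 by omega) (show q / 2 + 1 ≤ q by omega), h₂,
    h₃, ← two_mul]
  rfl

theorem digamma_q_sub_p_formula (p q : ℕ) (hp : 1 ≤ p) (hpq : p < q)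
    (hgcd : Nat.gcd p q = 1) :
    digamma (((q : ℝ) - p) / q) =
      -Real.eulerMascheroniConstant - Real.log (2 * q)
        + (Real.pi / 2) * Real.cot (Real.pi * p / q)
        + 2 * ∑ j ∈ Finset.Icc 1 (q / 2),
            Real.cos (2 * Real.pi * p * j / q) * Real.log (Real.sin (Real.pi * j / q)) := by
  have hq : 0 < q := by omega
  have hqR : (0 : ℝ) < q := by exact_mod_cast hq
  have hpR : (0 : ℝ) < p := by exact_mod_cast hp
  have hpqR : (p : ℝ) / q < 1 := (div_lt_one hqR).mpr (by exact_mod_cast hpq)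
  have hodd := digamma_one_sub_sub_digamma (x := p / q) (by positivity) hpqR
  have heven := digamma_add_digamma_one_sub hp hpq
  have hcos : ∑ j ∈ range (q - 1), Real.cos (2 * Real.pi * p * (j + 1) / q) = -1 := by
    have h := sum_cos_two_pi_mul_div hq p
    rw [if_neg fun h => absurd (Nat.le_of_dvd hp (by exact_mod_cast h)) (by omega)] at h
    rw [show range q = range (q - 1 + 1) by congr 1; omega, sum_range_succ'] at h
    simp only [Int.cast_natCast, Nat.cast_zero, mul_zero, zero_div, Real.cos_zero, Nat.cast_add,
      Nat.cast_one] at h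
    linarith
  have hsplit : ∑ j ∈ range (q - 1), 2 * (1 - Real.cos (2 * Real.pi * p * (j + 1) / q)) *
        -Real.log (2 * Real.sin (Real.pi * (j + 1) / q)) =
      -2 * ∑ j ∈ range (q - 1), Real.log (2 * Real.sin (Real.pi * (j + 1) / q)) +
      2 * Real.log 2 * ∑ j ∈ range (q - 1), Real.cos (2 * Real.pi * p * (j + 1) / q) +
      2 * ∑ j ∈ range (q - 1), Real.cos (2 * Real.pi * p * (j + 1 : ℕ) / q) *
        Real.log (Real.sin (Real.pi * (j + 1 : ℕ) / q)) := by
    simp only [mul_sum, ← sum_add_distrib]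
    refine sum_congr rfl fun j hj => ?_
    have hj : (j : ℝ) + 1 < q := by
      have := mem_range.mp hj
      exact_mod_cast (by omega : j + 1 < q)
    have hs : 0 < Real.sin (Real.pi * (j + 1) / q) := by
      refine Real.sin_pos_of_pos_of_lt_pi (by positivity) ?_
      rw [div_lt_iff₀ hqR]
      exact mul_lt_mul_of_pos_left hj Real.pi_pos
    rw [Real.log_mul two_ne_zero hs.ne']
    push_cast
    ring
  have hfold := sum_range_pred_of_symm hq (fun j : ℕ =>
    Real.cos (2 * Real.pi * p * j / q) * Real.log (Real.sin (Real.pi * j / q))) (fun j _ hj => by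
      have e₁ : 2 * Real.pi * p * (q - j : ℕ) / q =
          p * (2 * Real.pi) - 2 * Real.pi * p * j / q := by
        rw [Nat.cast_sub hj.le]; field_simp
      have e₂ : Real.pi * (q - j : ℕ) / q = Real.pi - Real.pi * j / q := by
        rw [Nat.cast_sub hj.le]; field_simp
      simp only [e₁, e₂, Real.cos_nat_mul_two_pi_sub, Real.sin_pi_sub]) (fun j hj => by
      have hj' : (0 : ℝ) < j := by exact_mod_cast (by omega : 0 < j)
      have e : Real.pi * j / q = Real.pi / 2 := by
        rw [← hj]; push_cast; field_simp
      simp [e])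
  rw [hsplit, sum_log_two_mul_sin hq, hcos, hfold] at heven
  rw [sub_div, div_self hqR.ne', Real.log_mul two_ne_zero hqR.ne', mul_div_assoc Real.pi]
  linear_combination hodd / 2 + heven / 2
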